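/- arXiv:0806.4899 — 2 statements merged into one kernel-verified Lean document; each statement's English description precedes it below -/
import Mathlib

section
/- Let r ≥ 2, let N ≥ 2 with (r−1) dividing (N−1), let p_1 ≤ p_2 ≤ ... ≤ p_N be strictly positive real numbers, and let D be a positive integer with r^D ≥ N. Then H(D, (N−1)/(r−1)) equals the minimum, over all prefix-free codes w of size N over an alphabet with r letters satisfying |w_i| ≤ D for all i, of the cost sum_{i=1}^N p_i·|w_i| (the equality being between elements of [0,∞]). -/
open scoped ENNReal

/-- Prefix sum `S_m = p_1 + ... + p_m`, viewed in `[0,∞]`. -/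
noncomputable def prefSum (p : ℕ → ℝ) (m : ℕ) : ℝ≥0∞ :=
  ENNReal.ofReal (∑ i ∈ Finset.Icc 1 m, p i)

/-- The cost family `c_{i,j}` of the `r`-ary length-limited Huffman DP with `N` weights:
`c_{0,0} = 0`, `c_{i,j} = S_{ri-j}` if `max(0, ri-N) ≤ j < i`, and `∞` otherwise. -/
noncomputable def cAry (N r : ℕ) (p : ℕ → ℝ) (i j : ℕ) : ℝ≥0∞ :=
  if i = 0 ∧ j = 0 then 0
  else if r * i - N ≤ j ∧ j < i then prefSum p (r * i - j)
  else ⊤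

/-- The DP: `H(0,0)=0`, `H(0,i)=∞` for `i>0`, and
`H(d,i) = min_{0 ≤ j ≤ i} (H(d-1,j) + c_{i,j})`. -/
noncomputable def dpH (N r : ℕ) (p : ℕ → ℝ) : ℕ → ℕ → ℝ≥0∞
  | 0, i => if i = 0 then 0 else ⊤
  | d + 1, i => (Finset.range (i + 1)).inf fun j => dpH N r p d j + cAry N r p i j

section words
variable {α : Type} [Fintype α]

open Classical in
noncomputable def wordsOf (α : Type) [Fintype α] (d : ℕ) : Finset (List α) :=
  Finset.univ.image (fun v : List.Vector α d => v.1)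

lemma mem_wordsOf (d : ℕ) (x : List α) : x ∈ wordsOf α d ↔ x.length = d := by
  classical
  unfold wordsOf
  constructor
  · intro h
    obtain ⟨v, -, rfl⟩ := Finset.mem_image.1 h
    exact v.2
  · intro h
    exact Finset.mem_image.2 ⟨⟨x, h⟩, Finset.mem_univ _, rfl⟩

lemma card_wordsOf (d : ℕ) : (wordsOf α d).card = Fintype.card α ^ d := by
  classical
  unfold wordsOf
  have hinj : Function.Injective (fun v : List.Vector α d => v.1) := Subtype.val_injective
  rw [Finset.card_image_of_injective _ hinj, Finset.card_univ, card_vector]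

open Classical in
noncomputable def extOf (u : List α) (d : ℕ) : Finset (List α) :=
  (wordsOf α (d - u.length)).image (fun x => u ++ x)

lemma mem_extOf (u : List α) (d : ℕ) (h : u.length ≤ d) (x : List α) :
    x ∈ extOf u d ↔ u <+: x ∧ x.length = d := by
  classical
  unfold extOf
  simp only [Finset.mem_image, mem_wordsOf]
  constructor
  · rintro ⟨y, hy, rfl⟩
    refine ⟨List.prefix_append _ _, ?_⟩
    simp; omega
  · rintro ⟨⟨y, rfl⟩, hx⟩
    refine ⟨y, ?_, rfl⟩
    simp at hx; omega

lemma card_extOf (u : List α) (d : ℕ) :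
    (extOf u d).card = Fintype.card α ^ (d - u.length) := by
  classical
  unfold extOf
  rw [Finset.card_image_of_injective _ (List.append_right_injective u), card_wordsOf]

lemma kraft_fwd (s : Finset ℕ) (w : ℕ → List α) (d : ℕ)
    (h1 : ∀ i ∈ s, ∀ j ∈ s, i ≠ j → ¬ w i <+: w j) (h2 : ∀ i ∈ s, (w i).length ≤ d) :
    ∑ i ∈ s, Fintype.card α ^ (d - (w i).length) ≤ Fintype.card α ^ d := by
  classical
  have : (s.biUnion fun i => extOf (w i) d).card = ∑ i ∈ s, Fintype.card α ^ (d - (w i).length) := by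
    rw [Finset.card_biUnion]
    · simp [card_extOf]
    · intro i hi j hj hij
      refine Finset.disjoint_left.2 ?_
      intro x hx hx'
      rw [mem_extOf _ _ (h2 _ hi)] at hx
      rw [mem_extOf _ _ (h2 _ hj)] at hx'
      rcases List.prefix_or_prefix_of_prefix hx.1 hx'.1 with h | h
      · exact h1 i hi j hj hij h
      · exact h1 j hj i hi hij.symm h
  rw [← this, ← card_wordsOf]
  apply Finset.card_le_card
  intro x hx
  obtain ⟨i, hi, hx⟩ := Finset.mem_biUnion.1 hx
  rw [mem_extOf _ _ (h2 _ hi)] at hx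
  rw [mem_wordsOf]; exact hx.2

lemma kraft_bwd (hc : 2 ≤ Fintype.card α) (D : ℕ) (L : ℕ → ℕ) (hL : Monotone L) (n : ℕ)
    (hLD : ∀ i < n, L i ≤ D)
    (hs : ∑ i ∈ Finset.range n, Fintype.card α ^ (D - L i) ≤ Fintype.card α ^ D) :
    ∃ w : ℕ → List α, (∀ i < n, (w i).length = L i) ∧
      ∀ i < n, ∀ j < n, i ≠ j → ¬ w i <+: w j := by
  classical
  induction n with
  | zero => exact ⟨fun _ => [], by simp, by simp⟩
  | succ n ih =>
    rw [Finset.sum_range_succ] at hs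
    obtain ⟨w, hw, hp⟩ := ih (fun i hi => hLD i (by omega)) (by omega)
    have hcard : ((Finset.range n).biUnion fun i => extOf (w i) (L n)).card
        < (wordsOf α (L n)).card := by
      refine lt_of_le_of_lt Finset.card_biUnion_le ?_
      rw [card_wordsOf]
      have hpos : 0 < Fintype.card α ^ (D - L n) := by positivity
      have hD := hLD n (by omega)
      refine lt_of_mul_lt_mul_right (a := Fintype.card α ^ (D - L n)) ?_ (Nat.zero_le _)
      rw [Finset.sum_mul, ← pow_add, Nat.add_sub_cancel' hD]
      refine lt_of_lt_of_le ?_ hs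
      have : ∑ i ∈ Finset.range n, (extOf (w i) (L n)).card * Fintype.card α ^ (D - L n)
          = ∑ i ∈ Finset.range n, Fintype.card α ^ (D - L i) := by
        apply Finset.sum_congr rfl
        intro i hi
        have hi := Finset.mem_range.1 hi
        rw [card_extOf, ← pow_add, hw i hi]
        have := hL hi.le
        congr 1; omega
      omega
    obtain ⟨x, hx, hx'⟩ := Finset.exists_mem_notMem_of_card_lt_card hcard
    rw [mem_wordsOf] at hx
    have hno : ∀ i < n, ¬ w i <+: x := by
      intro i hi hpre
      apply hx'
      refine Finset.mem_biUnion.2 ⟨i, Finset.mem_range.2 hi, ?_⟩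
      rw [mem_extOf _ _ (by rw [hw i hi]; exact hL hi.le)]
      exact ⟨hpre, hx⟩
    refine ⟨fun i => if i = n then x else w i, ?_, ?_⟩
    · intro i hi
      by_cases h : i = n
      · simp [h, hx]
      · simp [h, hw i (by omega)]
    · intro i hi j hj hij
      by_cases h : i = n
      · have hj' : j ≠ n := by omega
        simp only [h, hj', if_true, if_false]
        intro hpre
        have hjn : j < n := by omega
        have h3 := hL hjn.le
        have h4 := hpre.length_le
        rw [hx, hw j hjn] at h4
        have h5 := hpre.eq_of_length (by rw [hx, hw j hjn]; omega)
        exact hno j hjn (h5 ▸ List.prefix_refl _)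
      · by_cases h' : j = n
        · simp only [h, h', if_true, if_false]
          exact hno i (by omega)
        · simp only [h, h', if_false]
          exact hp i (by omega) j (by omega) hij

end words

lemma dp_path (N r : ℕ) (hr : 2 ≤ r) (p : ℕ → ℝ) (d : ℕ) : ∀ i, dpH N r p d i ≠ ⊤ →
    ∃ m : ℕ → ℕ, (∀ k < d, m k ≤ N) ∧
      dpH N r p d i = ∑ k ∈ Finset.range d, prefSum p (m k) ∧
      ∑ k ∈ Finset.range d, m k * r ^ k = i * r ^ d := by
  induction d with
  | zero =>
    intro i hi
    by_cases h : i = 0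
    · exact ⟨fun _ => 0, by simp, by simp [dpH, h], by simp [h]⟩
    · simp [dpH, h] at hi
  | succ d ih =>
    intro i hi
    obtain ⟨j, hj, hje⟩ := Finset.exists_mem_eq_inf (Finset.range (i+1)) ⟨0, by simp⟩
      (fun j => dpH N r p d j + cAry N r p i j)
    have he : dpH N r p (d+1) i = dpH N r p d j + cAry N r p i j := hje
    rw [he] at hi ⊢
    have h1 : dpH N r p d j ≠ ⊤ := fun h => hi (by simp [h])
    have h2 : cAry N r p i j ≠ ⊤ := fun h => hi (by simp [h])
    obtain ⟨m, hm, hc, hsum⟩ := ih j h1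
    have key : ∃ x, x ≤ N ∧ cAry N r p i j = prefSum p x ∧ x + j = r * i := by
      unfold cAry at h2 ⊢
      split_ifs at h2 ⊢ with ha hb
      · exact ⟨0, by omega, by simp [prefSum], by simp [ha.1, ha.2]⟩
      · refine ⟨r * i - j, by omega, rfl, ?_⟩
        have : i ≤ r * i := Nat.le_mul_of_pos_left _ (by omega)
        omega
      · exact absurd rfl h2
    obtain ⟨x, hx, hcx, hxj⟩ := key
    refine ⟨fun k => if k = d then x else m k, ?_, ?_, ?_⟩
    · intro k hk
      by_cases h : k = d
      · simp [h, hx]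
      · simp [h, hm k (by omega)]
    · rw [Finset.sum_range_succ, hc, hcx]
      simp only [if_true]
      congr 1
      apply Finset.sum_congr rfl
      intro k hk
      have := Finset.mem_range.1 hk
      rw [if_neg (by omega)]
    · rw [Finset.sum_range_succ]
      simp only [if_true]
      rw [show ∑ k ∈ Finset.range d, (if k = d then x else m k) * r ^ k
        = ∑ k ∈ Finset.range d, m k * r ^ k from ?_, hsum, ← add_mul, add_comm, hxj, pow_succ]
      · ring
      · apply Finset.sum_congr rfl
        intro k hk
        have := Finset.mem_range.1 hk
        rw [if_neg (by omega)]

lemma dp_le (N r : ℕ) (hr : 2 ≤ r) (p : ℕ → ℝ) (m I : ℕ → ℕ) (h0 : I 0 = 0) (d : ℕ)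
    (hm : ∀ k < d, m k ≤ N) (hI : ∀ k < d, r * I (k+1) = m k + I k)
    (hz : ∀ k < d, m k = 0 → I (k+1) = 0)
    (hlt : ∀ k < d, m k ≠ 0 → I k < I (k+1)) :
    dpH N r p d (I d) ≤ ∑ k ∈ Finset.range d, prefSum p (m k) := by
  induction d with
  | zero => simp [dpH, h0]
  | succ d ih =>
    have ih := ih (fun k hk => hm k (by omega)) (fun k hk => hI k (by omega))
      (fun k hk => hz k (by omega)) (fun k hk => hlt k (by omega))
    have hId := hI d (by omega)
    have hmd := hm d (by omega)
    have hld := hlt d (by omega)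
    have hle : I d ≤ I (d+1) ∧ cAry N r p (I (d+1)) (I d) = prefSum p (m d) := by
      by_cases h : m d = 0
      · have h1 := hz d (by omega) h
        rw [h1] at hId ⊢
        have h2 : I d = 0 := by omega
        simp [h2, h, cAry, prefSum]
      · have := hld h
        refine ⟨this.le, ?_⟩
        unfold cAry
        rw [if_neg (by omega), if_pos (by omega)]
        congr 1; omega
    rw [Finset.sum_range_succ, ← hle.2]
    refine le_trans ?_ (add_le_add_left ih _)
    exact Finset.inf_le (f := fun j => dpH N r p d j + cAry N r p (I (d+1)) j)
      (Finset.mem_range.2 (by omega))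

lemma geo_le (r : ℕ) (hr : 2 ≤ r) (D : ℕ) : ∀ T : Finset ℕ, T ⊆ Finset.range D →
    (r - 1) * ∑ k ∈ T, r ^ k + r ^ (D - T.card) ≤ r ^ D := by
  obtain ⟨q, rfl⟩ : ∃ q, r = q + 1 := ⟨r - 1, by omega⟩
  simp only [Nat.add_sub_cancel]
  induction D with
  | zero =>
    intro T hT
    have : T = ∅ := by simpa using hT
    simp [this]
  | succ D ih =>
    intro T hT
    by_cases h : D ∈ T
    · have hs : T.erase D ⊆ Finset.range D := by
        intro x hx
        have h1 := Finset.mem_erase.1 hx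
        have := Finset.mem_range.1 (hT h1.2)
        exact Finset.mem_range.2 (by omega)
      have h2 := ih _ hs
      have hc := Finset.card_erase_add_one h
      rw [← Finset.add_sum_erase _ _ h, ← hc, Nat.add_sub_add_right, pow_succ]
      nlinarith
    · have hs : T ⊆ Finset.range D := by
        intro x hx
        have := Finset.mem_range.1 (hT hx)
        have : x ≠ D := fun e => h (e ▸ hx)
        exact Finset.mem_range.2 (by omega)
      have h2 := ih _ hs
      have hc := Finset.card_le_card hs
      rw [Finset.card_range] at hc
      rw [Nat.succ_sub hc, pow_succ, pow_succ]
      calc _ ≤ (q * ∑ k ∈ T, (q+1) ^ k + (q+1) ^ (D - T.card)) * (q+1) := by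
            rw [add_mul]
            exact Nat.add_le_add_right (Nat.le_mul_of_pos_right _ (by omega)) _
        _ ≤ _ := by gcongr

lemma card_mod (r : ℕ) (hr : 2 ≤ r) (s : Finset ℕ) (f : ℕ → ℕ) :
    ∑ i ∈ s, r ^ f i ≡ s.card [MOD (r - 1)] := by
  classical
  have h1 : r ≡ 1 [MOD (r-1)] := ((Nat.modEq_iff_dvd' (by omega)).2 (dvd_refl _)).symm
  induction s using Finset.induction_on with
  | empty => simp; rfl
  | insert a s ha ih =>
    rw [Finset.sum_insert ha, Finset.card_insert_of_notMem ha, add_comm]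
    refine ih.add ?_
    simpa using h1.pow (f a)

lemma tighten (N r : ℕ) (hr : 2 ≤ r) (hN : 2 ≤ N) (hdvd : (r - 1) ∣ (N - 1)) (D : ℕ) (n : ℕ) :
    ∀ l : ℕ → ℕ, ∑ i ∈ Finset.Icc 1 N, l i = n → (∀ i ∈ Finset.Icc 1 N, l i ≤ D) →
    ∑ i ∈ Finset.Icc 1 N, r ^ (D - l i) ≤ r ^ D →
    ∃ l' : ℕ → ℕ, (∀ i ∈ Finset.Icc 1 N, l' i ≤ l i) ∧
      ∑ i ∈ Finset.Icc 1 N, r ^ (D - l' i) = r ^ D := by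
  classical
  induction n using Nat.strong_induction_on with
  | _ n ih =>
  intro l hn hD hk
  rcases hk.eq_or_lt with h | hlt
  · exact ⟨l, fun _ _ => le_rfl, h⟩
  obtain ⟨i0, hi0, hmax⟩ := Finset.exists_max_image (Finset.Icc 1 N) l ⟨1, by simp; omega⟩
  have hLD := hD i0 hi0
  have hQ : ∑ i ∈ Finset.Icc 1 N, r ^ (D - l i)
      = r ^ (D - l i0) * ∑ i ∈ Finset.Icc 1 N, r ^ (l i0 - l i) := by
    rw [Finset.mul_sum]
    apply Finset.sum_congr rfl
    intro i hi
    have := hmax i hi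
    rw [← pow_add]; congr 1; omega
  set Q := ∑ i ∈ Finset.Icc 1 N, r ^ (l i0 - l i) with hQdef
  have hrD : r ^ D = r ^ (D - l i0) * r ^ (l i0) := by rw [← pow_add]; congr 1; omega
  have hQlt : Q < r ^ (l i0) := by
    rw [hQ, hrD] at hlt
    exact lt_of_mul_lt_mul_left hlt (Nat.zero_le _)
  have h1 : r ≡ 1 [MOD (r-1)] := ((Nat.modEq_iff_dvd' (by omega)).2 (dvd_refl _)).symm
  have hNm : N ≡ 1 [MOD (r-1)] := ((Nat.modEq_iff_dvd' (by omega)).2 hdvd).symm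
  have hmod : Q ≡ r ^ (l i0) [MOD (r-1)] := by
    have h2 := card_mod r hr (Finset.Icc 1 N) (fun i => l i0 - l i)
    rw [Nat.card_Icc, Nat.add_sub_cancel] at h2
    have h3 := h1.pow (l i0)
    rw [one_pow] at h3
    exact (h2.trans hNm).trans h3.symm
  have hQle : Q + (r - 1) ≤ r ^ (l i0) := by
    have := Nat.le_of_dvd (by omega) ((Nat.modEq_iff_dvd' hQlt.le).1 hmod)
    omega
  have hl1 : 1 ≤ l i0 := by
    by_contra hc
    have h0 : l i0 = 0 := by omega
    have : N ≤ Q := by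
      rw [hQdef]
      calc N = ∑ i ∈ Finset.Icc 1 N, 1 := by simp
        _ ≤ _ := Finset.sum_le_sum (fun i _ => Nat.one_le_pow _ _ (by omega))
    rw [h0] at hQlt
    simp at hQlt
    omega
  let l1 : ℕ → ℕ := fun i => if i = i0 then l i0 - 1 else l i
  have hl1le : ∀ i, l1 i ≤ l i := by
    intro i
    by_cases h : i = i0
    · simp [l1, h]
    · simp [l1, h]
  have e1 : ∀ g : ℕ → ℕ, ∑ i ∈ (Finset.Icc 1 N).erase i0, g (l1 i)
      = ∑ i ∈ (Finset.Icc 1 N).erase i0, g (l i) := by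
    intro g
    apply Finset.sum_congr rfl
    intro i hi
    simp [l1, (Finset.mem_erase.1 hi).1]
  have hv : l1 i0 = l i0 - 1 := by simp [l1]
  obtain ⟨l', hl', hs⟩ := ih (∑ i ∈ Finset.Icc 1 N, l1 i) (by
      rw [← hn, ← Finset.add_sum_erase _ _ hi0, ← Finset.add_sum_erase _ l hi0, e1 (fun x => x), hv]
      omega) l1 rfl (fun i hi => (hl1le i).trans (hD i hi)) (by
      rw [← Finset.add_sum_erase _ _ hi0] at hQ ⊢
      rw [e1 (fun x => r ^ (D - x)), hv, show D - (l i0 - 1) = (D - l i0) + 1 by omega, pow_succ, hrD]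
      have := Nat.mul_le_mul_left (r ^ (D - l i0)) hQle
      rw [mul_add, ← hQ, Nat.mul_sub, mul_one] at this
      have h5 : r ^ (D - l i0) ≤ r ^ (D - l i0) * r := Nat.le_mul_of_pos_right _ (by omega)
      omega)
  exact ⟨l', fun i hi => (hl' i hi).trans (hl1le i), hs⟩

lemma path_of_len (N r : ℕ) (hr : 2 ≤ r) (hN : 2 ≤ N) (D : ℕ) (p : ℕ → ℝ)
    (l : ℕ → ℕ) (hD : ∀ i ∈ Finset.Icc 1 N, l i ≤ D)
    (hk : ∑ i ∈ Finset.Icc 1 N, r ^ (D - l i) = r ^ D) :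
    dpH N r p D ((N - 1) / (r - 1)) ≤ ∑ k ∈ Finset.range D,
      prefSum p ((Finset.Icc 1 N).filter (fun i => D < l i + (k + 1))).card := by
  classical
  have h1 : r ≡ 1 [MOD (r-1)] := ((Nat.modEq_iff_dvd' (by omega)).2 (dvd_refl _)).symm
  let F : ℕ → Finset ℕ := fun k => (Finset.Icc 1 N).filter (fun i => D < l i + k)
  let a : ℕ → ℕ := fun k => ∑ i ∈ F k, r ^ (D - l i)
  have ha : ∀ k, k ≤ D → ∃ b, a k = r ^ k * b := by
    intro k hkD
    have hsplit := Finset.sum_filter_add_sum_filter_not (Finset.Icc 1 N) (fun i => D < l i + k)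
      (fun i => r ^ (D - l i))
    rw [hk] at hsplit
    have hd : r ^ k ∣ ∑ i ∈ (Finset.Icc 1 N).filter (fun i => ¬ D < l i + k), r ^ (D - l i) := by
      apply Finset.dvd_sum
      intro i hi
      have := (Finset.mem_filter.1 hi).2
      exact pow_dvd_pow _ (by omega)
    have hd2 : r ^ k ∣ r ^ D := pow_dvd_pow _ hkD
    rw [← hsplit] at hd2
    exact (Nat.dvd_add_left hd).1 hd2
  have hb : ∀ k, k ≤ D → ∃ I, ((r - 1) * I) * r ^ k + a k = (F k).card * r ^ k := by
    intro k hkD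
    obtain ⟨b, hb⟩ := ha k hkD
    have hle : b ≤ (F k).card := by
      have : a k ≤ (F k).card * r ^ k := by
        rw [← smul_eq_mul]
        apply Finset.sum_le_card_nsmul
        intro i hi
        have := (Finset.mem_filter.1 hi).2
        exact Nat.pow_le_pow_right (by omega) (by omega)
      rw [hb, mul_comm] at this
      exact Nat.le_of_mul_le_mul_right this (by positivity)
    have hm : b ≡ (F k).card [MOD (r-1)] := by
      have h2 : a k ≡ (F k).card [MOD (r-1)] := card_mod r hr (F k) (fun i => D - l i)
      rw [hb] at h2
      have h3 := (h1.pow k).mul_right b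
      rw [one_pow, one_mul] at h3
      exact h3.symm.trans h2
    obtain ⟨I, hI⟩ := (Nat.modEq_iff_dvd' hle).1 hm
    refine ⟨I, ?_⟩
    rw [← hI, hb, mul_comm (r ^ k) b, ← add_mul, Nat.sub_add_cancel hle]
  choose! I hI using hb
  have hrpos : ∀ k, 0 < r ^ k := fun k => by positivity
  have hq : 0 < r - 1 := by omega
  have hF0 : F 0 = ∅ := by
    apply Finset.filter_eq_empty_iff.2
    intro i hi
    have := hD i hi
    omega
  have hI0 : I 0 = 0 := by
    have := hI 0 (by omega)
    simp [a, hF0] at this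
    omega
  have hID : I D = (N - 1) / (r - 1) := by
    have hFD : F D = Finset.Icc 1 N := by
      apply Finset.filter_true_of_mem
      intro i hi
      by_contra hc
      have h0 : l i = 0 := by omega
      rw [← Finset.add_sum_erase _ _ hi, h0] at hk
      have : 0 < ∑ x ∈ (Finset.Icc 1 N).erase i, r ^ (D - l x) := by
        apply Finset.sum_pos (fun x _ => hrpos _)
        rw [← Finset.card_pos, Finset.card_erase_of_mem hi, Nat.card_Icc]
        omega
      rw [Nat.sub_zero] at hk
      omega
    have h3 := hI D le_rfl
    have h4 : a D = 1 * r ^ D := by simp only [a, hFD, hk, one_mul]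
    rw [h4, ← add_mul, hFD, Nat.card_Icc] at h3
    have h5 := Nat.eq_of_mul_eq_mul_right (hrpos D) h3
    rw [show N - 1 = (r - 1) * I D by omega, Nat.mul_div_cancel_left _ hq]
  rw [← hID]
  have hstep : ∀ k < D, a (k+1) + (F k).card * r ^ k = a k + (F (k+1)).card * r ^ k := by
    intro k hkD
    have hsub : F k ⊆ F (k+1) := by
      intro i hi
      have := Finset.mem_filter.1 hi
      exact Finset.mem_filter.2 ⟨this.1, by omega⟩
    have e := Finset.sum_sdiff (f := fun i => r ^ (D - l i)) hsub
    have e2 := Finset.card_sdiff_add_card_eq_card hsub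
    have e3 : ∑ i ∈ F (k+1) \ F k, r ^ (D - l i) = (F (k+1) \ F k).card * r ^ k := by
      rw [Finset.sum_const_nat]
      intro i hi
      have h6 := Finset.mem_sdiff.1 hi
      have h7 := Finset.mem_filter.1 h6.1
      have h8 : ¬ D < l i + k := fun h => h6.2 (Finset.mem_filter.2 ⟨h7.1, h⟩)
      congr 1; omega
    rw [e3] at e
    simp only [a]
    rw [← e, ← e2]; ring
  have hrec : ∀ k < D, r * I (k+1) = (F (k+1)).card + I k := by
    intro k hk
    have h2 := hI k hk.le
    have h3 := hI (k+1) hk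
    have h4 := hstep k hk
    obtain ⟨q, rfl⟩ : ∃ q, r = q + 1 := ⟨r - 1, by omega⟩
    simp only [Nat.add_sub_cancel] at *
    have h5 : q * (q+1)^k * ((q+1) * I (k+1)) = q * (q+1)^k * ((F (k+1)).card + I k) := by
      rw [pow_succ] at h3
      nlinarith
    exact Nat.eq_of_mul_eq_mul_left (Nat.mul_pos hq (hrpos k)) h5
  apply dp_le N r hr p (fun k => (F (k+1)).card) I hI0 D
  · intro k hk
    have := Finset.card_filter_le (Finset.Icc 1 N) (fun i => D < l i + (k+1))
    rwa [Nat.card_Icc] at this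
  · exact hrec
  · intro k hk h0
    have h3 := hI (k+1) hk
    have h0 : (F (k+1)).card = 0 := h0
    rw [h0, zero_mul] at h3
    have h4 : (r - 1) * I (k+1) * r ^ (k+1) = 0 := by omega
    have := hrpos (k+1)
    simp only [mul_eq_zero] at h4
    omega
  · intro k hk h0
    have h3 := hI (k+1) hk
    have h6 : 0 < a (k+1) :=
      Finset.sum_pos (fun x _ => hrpos _) (Finset.card_pos.1 (Nat.pos_of_ne_zero h0))
    have h7 : (r - 1) * I (k+1) < (F (k+1)).card :=
      lt_of_mul_lt_mul_right (a := r ^ (k+1)) (by omega) (Nat.zero_le _)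
    have h8 := hrec k hk
    rw [Nat.sub_mul, one_mul] at h7
    omega

lemma sum_first_le (N : ℕ) (p : ℕ → ℝ)
    (hmono : ∀ i j, 1 ≤ i → i ≤ j → j ≤ N → p i ≤ p j) (s : Finset ℕ) (hs : s ⊆ Finset.Icc 1 N) :
    ∑ i ∈ Finset.Icc 1 s.card, p i ≤ ∑ i ∈ s, p i := by
  classical
  have hcN := Finset.card_le_card hs
  rw [Nat.card_Icc] at hcN
  set m := s.card with hm
  rcases Nat.eq_zero_or_pos m with h | h
  · have : s = ∅ := Finset.card_eq_zero.1 (hm.symm.trans h)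
    simp [h, this]
  have hcc : (Finset.Icc 1 m \ s).card = (s \ Finset.Icc 1 m).card := by
    apply Finset.card_sdiff_comm
    rw [Nat.card_Icc]; omega
  have e1 := Finset.sum_inter_add_sum_sdiff (Finset.Icc 1 m) s p
  have e2 := Finset.sum_inter_add_sum_sdiff s (Finset.Icc 1 m) p
  rw [Finset.inter_comm] at e2
  have l1 : ∑ i ∈ Finset.Icc 1 m \ s, p i ≤ (Finset.Icc 1 m \ s).card • p m := by
    apply Finset.sum_le_card_nsmul
    intro i hi
    have := Finset.mem_Icc.1 (Finset.mem_sdiff.1 hi).1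
    exact hmono i m this.1 this.2 (by omega)
  have l2 : (s \ Finset.Icc 1 m).card • p m ≤ ∑ i ∈ s \ Finset.Icc 1 m, p i := by
    apply Finset.card_nsmul_le_sum
    intro i hi
    have h1 := Finset.mem_sdiff.1 hi
    have h2 := Finset.mem_Icc.1 (hs h1.1)
    have h3 : ¬ (1 ≤ i ∧ i ≤ m) := fun h => h1.2 (Finset.mem_Icc.2 h)
    exact hmono m i (by omega) (by omega) h2.2
  rw [hcc] at l1
  linarith

theorem stmt_1 (N r : ℕ) (hr : 2 ≤ r) (hN : 2 ≤ N) (hdvd : (r - 1) ∣ (N - 1))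
    (p : ℕ → ℝ)
    (hpos : ∀ i, 1 ≤ i → i ≤ N → 0 < p i)
    (hmono : ∀ i j, 1 ≤ i → i ≤ j → j ≤ N → p i ≤ p j)
    (D : ℕ) (hD : 1 ≤ D) (hDN : N ≤ r ^ D)
    (α : Type) [Fintype α] (hcard : Fintype.card α = r) :
    dpH N r p D ((N - 1) / (r - 1)) =
      ⨅ (w : ℕ → List α)
        (_ : (∀ i ∈ Finset.Icc 1 N, ∀ j ∈ Finset.Icc 1 N, i ≠ j → ¬ w i <+: w j) ∧
             ∀ i ∈ Finset.Icc 1 N, (w i).length ≤ D),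
        ∑ i ∈ Finset.Icc 1 N, ENNReal.ofReal (p i) * ((w i).length : ℝ≥0∞) := by
  classical
  have hnn : ∀ i ∈ Finset.Icc 1 N, 0 ≤ p i := fun i hi =>
    (hpos i (Finset.mem_Icc.1 hi).1 (Finset.mem_Icc.1 hi).2).le
  apply le_antisymm
  · refine le_iInf fun w => le_iInf fun hw => ?_
    have hk := kraft_fwd (Finset.Icc 1 N) w D hw.1 hw.2
    rw [hcard] at hk
    obtain ⟨l, hl, hle⟩ := tighten N r hr hN hdvd D _ (fun i => (w i).length) rfl hw.2 hk
    have hlD : ∀ i ∈ Finset.Icc 1 N, l i ≤ D := fun i hi => (hl i hi).trans (hw.2 i hi)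
    calc _ ≤ _ := path_of_len N r hr hN D p l hlD hle
      _ ≤ ∑ k ∈ Finset.range D, ∑ i ∈ (Finset.Icc 1 N).filter (fun i => D < l i + (k + 1)),
            ENNReal.ofReal (p i) := by
          apply Finset.sum_le_sum
          intro k _
          unfold prefSum
          rw [← ENNReal.ofReal_sum_of_nonneg (fun i hi => hnn i (Finset.mem_filter.1 hi).1)]
          exact ENNReal.ofReal_le_ofReal (sum_first_le N p hmono _ (Finset.filter_subset _ _))
      _ = ∑ i ∈ Finset.Icc 1 N, ENNReal.ofReal (p i) * (l i : ℝ≥0∞) := by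
          simp_rw [Finset.sum_filter]
          rw [Finset.sum_comm]
          apply Finset.sum_congr rfl
          intro i hi
          rw [← Finset.sum_filter, Finset.sum_const, nsmul_eq_mul, mul_comm]
          congr 2
          have := hlD i hi
          have e : (Finset.range D).filter (fun k => D < l i + (k + 1)) = Finset.Ico (D - l i) D := by
            ext k
            simp only [Finset.mem_filter, Finset.mem_range, Finset.mem_Ico]
            omega
          rw [e, Nat.card_Ico]; omega
      _ ≤ _ := by
          apply Finset.sum_le_sum
          intro i hi
          gcongr
          exact hl i hi
  · by_cases htop : dpH N r p D ((N - 1) / (r - 1)) = ⊤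
    · rw [htop]; exact le_top
    obtain ⟨m, hm, hc, hs⟩ := dp_path N r hr p D _ htop
    let T : ℕ → Finset ℕ := fun i => (Finset.range D).filter (fun k => i ≤ m k)
    have hTD : ∀ i, (T i).card ≤ D := fun i => by
      simpa using Finset.card_filter_le (Finset.range D) (fun k => i ≤ m k)
    have hTanti : ∀ i j, i ≤ j → (T j).card ≤ (T i).card := by
      intro i j hij
      apply Finset.card_le_card
      intro k hk
      have := Finset.mem_filter.1 hk
      exact Finset.mem_filter.2 ⟨this.1, hij.trans this.2⟩
    have hfil : ∀ k < D, (Finset.Icc 1 N).filter (fun i => i ≤ m k) = Finset.Icc 1 (m k) := by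
      intro k hk
      have := hm k hk
      ext i
      simp only [Finset.mem_filter, Finset.mem_Icc]
      omega
    have hsum : ∑ i ∈ Finset.Icc 1 N, ∑ k ∈ T i, r ^ k = ∑ k ∈ Finset.range D, m k * r ^ k := by
      simp only [T, Finset.sum_filter]
      rw [Finset.sum_comm]
      apply Finset.sum_congr rfl
      intro k hk
      rw [← Finset.sum_filter, hfil k (Finset.mem_range.1 hk)]
      simp
    have hkraft : ∑ i ∈ Finset.Icc 1 N, r ^ (D - (T i).card) ≤ r ^ D := by
      have h1 : ∑ i ∈ Finset.Icc 1 N, ((r - 1) * ∑ k ∈ T i, r ^ k + r ^ (D - (T i).card))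
          ≤ ∑ i ∈ Finset.Icc 1 N, r ^ D :=
        Finset.sum_le_sum fun i _ => geo_le r hr D (T i) (Finset.filter_subset _ _)
      rw [Finset.sum_add_distrib, ← Finset.mul_sum, hsum, hs, ← mul_assoc,
        Nat.mul_div_cancel' hdvd, Finset.sum_const, Nat.card_Icc, smul_eq_mul] at h1
      have h2 : (N + 1 - 1) * r ^ D = (N - 1) * r ^ D + r ^ D := by
        rw [show N + 1 - 1 = (N - 1) + 1 by omega]; ring
      omega
    obtain ⟨w, hw, hp⟩ := kraft_bwd (α := α) (by omega) D (fun i => (T (N - i)).card)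
      (fun i j hij => hTanti _ _ (by omega)) N (fun i _ => hTD _) (by
        rw [hcard]
        refine le_trans (le_of_eq ?_) hkraft
        apply Finset.sum_bij' (fun i _ => N - i) (fun i _ => N - i)
        · intro i hi; have := Finset.mem_range.1 hi; exact Finset.mem_Icc.2 (by omega)
        · intro i hi; have := Finset.mem_Icc.1 hi; exact Finset.mem_range.2 (by omega)
        · intro i hi; have := Finset.mem_range.1 hi; omega
        · intro i hi; have := Finset.mem_Icc.1 hi; omega
        · intro i hi; rfl)
    have hlen : ∀ i ∈ Finset.Icc 1 N, (w (N - i)).length = (T i).card := by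
      intro i hi
      have := Finset.mem_Icc.1 hi
      rw [hw _ (by omega)]
      congr 2; omega
    refine iInf_le_of_le (fun i => w (N - i)) (iInf_le_of_le ⟨?_, ?_⟩ ?_)
    · intro i hi j hj hij
      have := Finset.mem_Icc.1 hi
      have := Finset.mem_Icc.1 hj
      exact hp _ (by omega) _ (by omega) (by omega)
    · intro i hi
      rw [hlen i hi]; exact hTD i
    · rw [hc]
      apply le_of_eq
      calc _ = ∑ i ∈ Finset.Icc 1 N, ∑ k ∈ T i, ENNReal.ofReal (p i) := by
            apply Finset.sum_congr rfl
            intro i hi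
            rw [hlen i hi, Finset.sum_const, nsmul_eq_mul, mul_comm]
        _ = _ := by
            simp only [T, Finset.sum_filter]
            rw [Finset.sum_comm]
            apply Finset.sum_congr rfl
            intro k hk
            have hkD := Finset.mem_range.1 hk
            rw [← Finset.sum_filter, hfil k hkD, prefSum, ENNReal.ofReal_sum_of_nonneg]
            intro i hi
            have := Finset.mem_Icc.1 hi
            have := hm k hkD
            exact hnn i (Finset.mem_Icc.2 (by omega))
end

section
/- Let r ≥ 2, let N ≥ 2 with (r−1) dividing (N−1), and let p_1 ≤ p_2 ≤ ... ≤ p_N be nonnegative real numbers. Then for every d ≥ 0 and every 0 ≤ i ≤ (N−1)/(r−1), the value H(d,i) of the dynamic program equals the minimum of cost(I) over all valid (N,r)-sequences I = (i_0, i_1, ..., i_d) of length d with i_d = i, where the minimum over the empty set is ∞. -/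
open scoped ENNReal

/-- `I = (i_0, …, i_h)` is a valid `(N,r)`-sequence: there is `t ≤ h` with
`i_0 = ⋯ = i_t = 0` and `0 < i_{t+1} < ⋯ < i_h ≤ (N-1)/(r-1)`, and
`r·i_k − i_{k-1} ≤ N` for `1 ≤ k ≤ h`. -/
def ValidSeq (N r h : ℕ) (I : ℕ → ℕ) : Prop :=
  (∃ t ≤ h, (∀ k ≤ t, I k = 0) ∧ (∀ k, t ≤ k → k < h → I k < I (k + 1)) ∧
      I h ≤ (N - 1) / (r - 1)) ∧
  ∀ k, 1 ≤ k → k ≤ h → r * I k ≤ N + I (k - 1)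

/-- `cost(I) = ∑_{k=1}^h S_{r·i_k − i_{k-1}}`. -/
noncomputable def costSeq (r h : ℕ) (p : ℕ → ℝ) (I : ℕ → ℕ) : ℝ≥0∞ :=
  ∑ k ∈ Finset.Icc 1 h, prefSum p (r * I k - I (k - 1))

theorem aux_le (N r : ℕ) (p : ℕ → ℝ) : ∀ d I, ValidSeq N r d I →
    dpH N r p d (I d) ≤ costSeq r d p I := by
  intro d
  induction d with
  | zero =>
    rintro I ⟨⟨t, ht, h0, -, -⟩, -⟩
    simp [dpH, h0 0 (Nat.zero_le _)]
  | succ d ih =>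
    rintro I ⟨⟨t, ht, h0, hlt, hb⟩, hc⟩
    have hcase : (I d = 0 ∧ I (d+1) = 0) ∨ I d < I (d+1) := by
      rcases Nat.lt_or_ge d t with h | h
      · exact Or.inl ⟨h0 _ h.le, h0 _ h⟩
      · exact Or.inr (hlt d h (Nat.lt_succ_self d))
    have hle : I d ≤ I (d+1) := by omega
    have hv : ValidSeq N r d I := by
      refine ⟨⟨min t d, min_le_right _ _, fun k hk => h0 k (hk.trans (min_le_left _ _)), ?_,
        hle.trans hb⟩, fun k h1 h2 => hc k h1 (by omega)⟩
      intro k h1 h2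
      exact hlt k (by omega) (by omega)
    have hcost : costSeq r (d+1) p I = costSeq r d p I + prefSum p (r * I (d+1) - I d) := by
      unfold costSeq
      rw [Finset.sum_Icc_succ_top (by omega)]
      simp
    rw [hcost, dpH]
    refine (Finset.inf_le (b := I d) (by simp; omega)).trans (add_le_add (ih I hv) ?_)
    unfold cAry
    have hcc := hc (d+1) (by omega) le_rfl
    simp only [Nat.add_sub_cancel] at hcc
    rcases hcase with h | h
    · simp [h]
    · rw [if_neg (by omega), if_pos ⟨by omega, h⟩]

theorem aux_ge (N r : ℕ) (p : ℕ → ℝ) : ∀ d, ∀ i ≤ (N - 1) / (r - 1), dpH N r p d i ≠ ⊤ →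
    ∃ I, ValidSeq N r d I ∧ I d = i ∧ costSeq r d p I ≤ dpH N r p d i := by
  have hz : ∀ d, ∃ I, ValidSeq N r d I ∧ I d = 0 ∧ costSeq r d p I ≤ dpH N r p d 0 := by
    intro d
    refine ⟨fun _ => 0, ⟨⟨d, le_rfl, by simp, fun k h1 h2 => by omega, by simp⟩, by simp⟩, rfl, ?_⟩
    simp [costSeq, prefSum]
  intro d
  induction d with
  | zero =>
    intro i hi hne
    by_cases h : i = 0
    · subst h; exact hz 0
    · simp [dpH, h] at hne
  | succ d ih =>
    intro i hi hne
    by_cases h : i = 0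
    · subst h; exact hz _
    obtain ⟨j, hj, hje⟩ := Finset.exists_mem_eq_inf (Finset.range (i+1)) ⟨0, by simp⟩
      (fun j => dpH N r p d j + cAry N r p i j)
    rw [dpH, hje] at hne ⊢
    simp only [ne_eq, ENNReal.add_eq_top, not_or] at hne
    obtain ⟨hn1, hn2⟩ := hne
    have hcj : r * i - N ≤ j ∧ j < i := by
      by_contra hcon
      apply hn2
      rw [cAry, if_neg (by omega), if_neg hcon]
    have hcv : cAry N r p i j = prefSum p (r * i - j) := by
      rw [cAry, if_neg (by omega), if_pos hcj]
    obtain ⟨I, ⟨⟨t, ht, h0, hlt, hb⟩, hc⟩, hId, hcost⟩ := ih j (by omega) hn1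
    have hJ : ∀ k, k ≤ d → Function.update I (d+1) i k = I k := fun k hk =>
      Function.update_of_ne (by omega) _ _
    have hJd : Function.update I (d+1) i (d+1) = i := Function.update_self _ _ _
    refine ⟨Function.update I (d+1) i, ⟨⟨t, by omega, ?_, ?_, ?_⟩, ?_⟩, hJd, ?_⟩
    · intro k hk
      rw [hJ k (by omega)]; exact h0 k hk
    · intro k h1 h2
      rw [hJ k (by omega)]
      rcases Nat.lt_or_ge k d with h3 | h3
      · rw [hJ (k+1) (by omega)]; exact hlt k h1 h3
      · obtain rfl : k = d := by omega
        rw [hJd]; omega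
    · rw [hJd]; exact hi
    · intro k h1 h2
      rw [hJ (k-1) (by omega)]
      rcases Nat.lt_or_ge d k with h3 | h3
      · obtain rfl : k = d + 1 := by omega
        rw [hJd, Nat.add_sub_cancel, hId]; omega
      · rw [hJ k h3]; exact hc k h1 h3
    · have : costSeq r (d+1) p (Function.update I (d+1) i)
          = costSeq r d p I + prefSum p (r * i - j) := by
        unfold costSeq
        rw [Finset.sum_Icc_succ_top (by omega), hJd, Nat.add_sub_cancel, hJ d le_rfl, hId]
        congr 1
        apply Finset.sum_congr rfl
        intro k hk
        rw [Finset.mem_Icc] at hk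
        rw [hJ k hk.2, hJ (k-1) (by omega)]
      rw [this, hcv]
      gcongr

theorem stmt_4 (N r : ℕ) (hr : 2 ≤ r) (hN : 2 ≤ N) (hdvd : (r - 1) ∣ (N - 1))
    (p : ℕ → ℝ)
    (hnonneg : ∀ i, 1 ≤ i → i ≤ N → 0 ≤ p i)
    (hmono : ∀ i j, 1 ≤ i → i ≤ j → j ≤ N → p i ≤ p j) :
    ∀ d : ℕ, ∀ i ≤ (N - 1) / (r - 1),
      dpH N r p d i =
        ⨅ (I : ℕ → ℕ) (_ : ValidSeq N r d I ∧ I d = i), costSeq r d p I := by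
  intro d i hi
  apply le_antisymm
  · refine le_iInf₂ fun I hI => ?_
    rw [← hI.2]
    exact aux_le N r p d I hI.1
  · by_cases h : dpH N r p d i = ⊤
    · rw [h]; exact le_top
    · obtain ⟨I, h1, h2, h3⟩ := aux_ge N r p d i hi h
      exact (iInf₂_le I ⟨h1, h2⟩).trans h3
end
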